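/- arXiv:0807.1015 — 3 statements merged into one kernel-verified Lean document; each statement's English description precedes it below -/
import Mathlib

section
/- Let h be an invertible real d×d matrix (d ≥ 2), δ = diag(δ₁,…,δ_d) an invertible diagonal real d×d matrix with |δ₁| > 1 and |δ_d| < 1, and γ = h⁻¹δh. Fix β ∈ (0,1) and let U = {v ∈ ℝ^d \ {0} : ⟨hv, e₁⟩ > β‖hv‖ and ⟨hv, e_d⟩ > β‖hv‖}. Then the infimum over v ∈ U of log(‖γ^k v‖/‖v‖) + log(‖γ^{−k} v‖/‖v‖) tends to +∞ as k → +∞; i.e. the quantity log(‖γ^k v‖/‖v‖) + log(‖γ^{−k} v‖/‖v‖) tends to +∞ uniformly on U. -/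
open scoped Matrix

/-- The Euclidean norm on `ℝ^d`. -/
noncomputable def eNorm {d : ℕ} (v : Fin d → ℝ) : ℝ :=
  ‖(WithLp.equiv 2 (Fin d → ℝ)).symm v‖

/-- The standard Euclidean inner product on `ℝ^d`. -/
def eInner {d : ℕ} (v w : Fin d → ℝ) : ℝ := ∑ i, v i * w i

theorem aux_bound {d : ℕ} (h : Matrix (Fin d) (Fin d) ℝ) :
    ∃ M : ℝ, 0 < M ∧ ∀ v, eNorm (h.mulVec v) ≤ M * eNorm v := by
  refine ⟨‖Matrix.toEuclideanCLM (n := Fin d) (𝕜 := ℝ) h‖ + 1, by positivity, fun v => ?_⟩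
  have h1 := (Matrix.toEuclideanCLM (n := Fin d) (𝕜 := ℝ) h).le_opNorm (WithLp.toLp 2 v)
  have h2 : eNorm (h.mulVec v) = ‖Matrix.toEuclideanCLM (n := Fin d) (𝕜 := ℝ) h (WithLp.toLp 2 v)‖ := by
    simp [eNorm]
  have h3 : eNorm v = ‖(WithLp.toLp 2 v : EuclideanSpace ℝ (Fin d))‖ := by
    simp [eNorm]
  rw [h2, h3]
  refine h1.trans ?_
  gcongr
  linarith

theorem aux_coord {d : ℕ} (v : Fin d → ℝ) (i : Fin d) : |v i| ≤ eNorm v := by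
  have := PiLp.norm_apply_le (WithLp.toLp 2 v : EuclideanSpace ℝ (Fin d)) i
  simpa [eNorm] using this

theorem aux_pos {d : ℕ} (v : Fin d → ℝ) (hv : v ≠ 0) : 0 < eNorm v := by
  simpa [eNorm] using hv

theorem aux_main {d : ℕ} (h : Matrix (Fin d) (Fin d) ℝ) (hh : IsUnit h.det) (β : ℝ) (hβ : 0 < β) :
    ∃ c : ℝ, 0 < c ∧ ∀ (g : Matrix (Fin d) (Fin d) ℝ) (b : Fin d → ℝ) (i : Fin d) (v : Fin d → ℝ),
      h * g = Matrix.diagonal b * h → v ≠ 0 →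
      β * eNorm (h.mulVec v) < eInner (h.mulVec v) (Pi.single i 1) →
      c * |b i| ≤ eNorm (g.mulVec v) / eNorm v := by
  obtain ⟨M, hM, hM'⟩ := aux_bound h
  obtain ⟨N, hN, hN'⟩ := aux_bound h⁻¹
  refine ⟨β / (M * N), by positivity, fun g b i v hg hv hi => ?_⟩
  have hv' := aux_pos v hv
  have hi' : eInner (h.mulVec v) (Pi.single i 1) = h.mulVec v i := by
    simp [eInner, Pi.single_apply]
  rw [hi'] at hi
  have e1 : eNorm v ≤ N * eNorm (h.mulVec v) := by
    have := hN' (h.mulVec v)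
    rwa [Matrix.mulVec_mulVec, Matrix.nonsing_inv_mul _ hh, Matrix.one_mulVec] at this
  have e2 := hM' (g.mulVec v)
  rw [Matrix.mulVec_mulVec, hg, ← Matrix.mulVec_mulVec] at e2
  have e3 := aux_coord ((Matrix.diagonal b).mulVec (h.mulVec v)) i
  rw [Matrix.mulVec_diagonal, abs_mul] at e3
  have e4 : β * eNorm (h.mulVec v) ≤ |h.mulVec v i| := hi.le.trans (le_abs_self _)
  rw [le_div_iff₀ hv', div_mul_eq_mul_div, div_mul_eq_mul_div, div_le_iff₀ (by positivity)]
  calc β * |b i| * eNorm v ≤ β * |b i| * (N * eNorm (h.mulVec v)) := by gcongr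
    _ = N * (|b i| * (β * eNorm (h.mulVec v))) := by ring
    _ ≤ N * (|b i| * |h.mulVec v i|) := by gcongr
    _ ≤ N * (M * eNorm (g.mulVec v)) := 
      mul_le_mul_of_nonneg_left (e3.trans e2) hN.le
    _ = _ := by ring

/-- Let `γ = h⁻¹ δ h` with `h` invertible, `δ = diag(δ₁,…,δ_d)` invertible diagonal with
`|δ₁| > 1` and `|δ_d| < 1`, and `β ∈ (0,1)`. On the set
`U = {v ≠ 0 : ⟨hv,e₁⟩ > β‖hv‖ and ⟨hv,e_d⟩ > β‖hv‖}`, the quantity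
`log(‖γ^k v‖/‖v‖) + log(‖γ^{-k} v‖/‖v‖)` tends to `+∞` as `k → +∞`, uniformly in `v ∈ U`. -/
theorem log_norm_sum_tendsto_atTop_uniformly {d : ℕ} (hd : 2 ≤ d)
    (h : Matrix (Fin d) (Fin d) ℝ) (hh : IsUnit h.det)
    (a : Fin d → ℝ) (ha : ∀ i, a i ≠ 0)
    (ha1 : 1 < |a ⟨0, by omega⟩|) (had : |a ⟨d - 1, by omega⟩| < 1)
    (γ : Matrix (Fin d) (Fin d) ℝ) (hγ : γ = h⁻¹ * Matrix.diagonal a * h)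
    (β : ℝ) (hβ : β ∈ Set.Ioo (0 : ℝ) 1)
    (U : Set (Fin d → ℝ))
    (hU : U = {v : Fin d → ℝ | v ≠ 0 ∧
      β * eNorm (h.mulVec v) < eInner (h.mulVec v) (Pi.single ⟨0, by omega⟩ 1) ∧
      β * eNorm (h.mulVec v) < eInner (h.mulVec v) (Pi.single ⟨d - 1, by omega⟩ 1)}) :
    ∀ C : ℝ, ∃ K : ℕ, ∀ k : ℕ, K ≤ k → ∀ v ∈ U,
      C ≤ Real.log (eNorm ((γ ^ (k : ℤ)).mulVec v) / eNorm v)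
            + Real.log (eNorm ((γ ^ (-(k : ℤ))).mulVec v) / eNorm v) := by
  intro C
  obtain ⟨c, hc, H⟩ := aux_main h hh β hβ.1
  set p : Fin d := ⟨0, by omega⟩
  set q : Fin d := ⟨d - 1, by omega⟩
  have hδ : IsUnit (Matrix.diagonal a).det := by
    rw [Matrix.det_diagonal, isUnit_iff_ne_zero]
    exact Finset.prod_ne_zero_iff.2 fun i _ => ha i
  have hγu : IsUnit γ.det := by
    rw [hγ, Matrix.det_mul, Matrix.det_mul]
    exact ((Matrix.isUnit_nonsing_inv_det h hh).mul hδ).mul hh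
  have hs : SemiconjBy h γ (Matrix.diagonal a) := by
    rw [SemiconjBy, hγ, ← mul_assoc, ← mul_assoc, Matrix.mul_nonsing_inv _ hh, one_mul]
  have hz := Matrix.SemiconjBy.zpow_right hγu hδ hs
  have hp : 0 < Real.log |a p| := Real.log_pos ha1
  have hq0 : 0 < |a q| := abs_pos.2 (ha q)
  have hq : Real.log |a q| < 0 := Real.log_neg hq0 had
  obtain ⟨K, hK⟩ := exists_nat_ge ((C - 2 * Real.log c) / Real.log |a p|)
  refine ⟨K, fun k hk v hv => ?_⟩
  rw [hU] at hv
  obtain ⟨hv0, hv1, hv2⟩ := hv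
  have b1 := H (γ ^ (k : ℤ)) (a ^ k) p v (by
    rw [← Matrix.diagonal_pow, ← zpow_natCast]; exact hz k) hv0 hv1
  have b2 := H (γ ^ (-(k : ℤ))) (fun i => (a i ^ k)⁻¹) q v (by
    have e : (Matrix.diagonal a) ^ (-(k : ℤ)) = Matrix.diagonal (fun i => (a i ^ k)⁻¹) := by
      rw [Matrix.zpow_neg hδ, zpow_natCast, Matrix.diagonal_pow]
      apply Matrix.inv_eq_left_inv
      rw [Matrix.diagonal_mul_diagonal, ← Matrix.diagonal_one]
      congr 1
      ext i
      simp [ha i]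
    rw [← e]; exact hz _) hv0 hv2
  have ap : 0 < |a p| := by linarith
  simp only [Pi.pow_apply, abs_pow, abs_inv] at b1 b2
  have l1 := Real.log_le_log (by positivity) b1
  have l2 := Real.log_le_log (by positivity) b2
  rw [Real.log_mul (by positivity) (by positivity), Real.log_pow] at l1
  rw [Real.log_mul (by positivity) (by positivity), Real.log_inv, Real.log_pow] at l2
  have hk' : (K : ℝ) ≤ k := by exact_mod_cast hk
  have := (div_le_iff₀ hp).1 (hK.trans hk')
  have : (k : ℝ) * Real.log |a q| ≤ 0 :=
    mul_nonpos_of_nonneg_of_nonpos (Nat.cast_nonneg k) hq.le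
  linarith
end

section
/- Let Γ be a countable group acting by homeomorphisms on a compact Hausdorff topological space X (equipped with its Borel σ-algebra). Let μ be a probability measure on Γ whose support generates Γ as a semigroup, and let L ⊆ X be a nonempty compact Γ-invariant subset on which the action of Γ is minimal, i.e. every nonempty closed Γ-invariant subset of L equals L. Let U ⊆ X be open with U ∩ L ≠ ∅. Suppose (η_k)_{k∈ℕ} are probability measures on Γ with η_k({g}) ≥ (1/2)μ({g}) for all g ∈ Γ and all k, and (ν_k)_{k∈ℕ} are Borel probability measures on X such that ν_k(L) = 1 and ν_k is η_k-stationary, i.e. ν_k(B) = ∑_{g∈Γ} η_k({g}) ν_k(g⁻¹B) for every Borel set B ⊆ X. Then there exists c > 0 such that ν_k(U) ≥ c for all k. -/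
open MeasureTheory Set
open scoped Pointwise ENNReal

/-- Let a countable group `Γ` act by homeomorphisms on a compact Hausdorff space `X`, let `μ`
be a probability measure on `Γ` whose support generates `Γ` as a semigroup, and let `L` be a
nonempty compact `Γ`-invariant set on which the action is minimal. If `U` is open with
`U ∩ L ≠ ∅`, and `(ν_k)` are `η_k`-stationary Borel probability measures with `ν_k(L) = 1`,
where `η_k({g}) ≥ (1/2)μ({g})` for all `g, k`, then the `ν_k(U)` are uniformly bounded away
from zero. -/
theorem stationary_measures_of_open_set_uniformly_positive
    {Γ X : Type*} [Group Γ] [Countable Γ] [MeasurableSpace Γ] [MeasurableSingletonClass Γ]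
    [TopologicalSpace X] [CompactSpace X] [T2Space X] [MeasurableSpace X] [BorelSpace X]
    [MulAction Γ X] (hcont : ∀ g : Γ, Continuous fun x : X => g • x)
    (μ : Measure Γ) [IsProbabilityMeasure μ]
    (hgen : ∀ g : Γ, ∃ l : List Γ, (∀ x ∈ l, 0 < μ {x}) ∧ l.prod = g)
    (L : Set X) (hLne : L.Nonempty) (hLcomp : IsCompact L)
    (hLinv : ∀ g : Γ, g • L = L)
    (hmin : ∀ C : Set X, C ⊆ L → C.Nonempty → (∀ g : Γ, g • C = C) →
      IsClosed ((fun z : L => (z : X)) ⁻¹' C) → C = L)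
    (U : Set X) (hUopen : IsOpen U) (hUL : (U ∩ L).Nonempty)
    (η : ℕ → Measure Γ) (hη : ∀ k, IsProbabilityMeasure (η k))
    (hηdom : ∀ (k : ℕ) (g : Γ), (1 / 2 : ℝ≥0∞) * μ {g} ≤ η k {g})
    (ν : ℕ → Measure X) (hν : ∀ k, IsProbabilityMeasure (ν k))
    (hνL : ∀ k, ν k L = 1)
    (hstat : ∀ (k : ℕ) (B : Set X), MeasurableSet B →
      ν k B = ∑' g : Γ, η k {g} * ν k (g⁻¹ • B)) :
    ∃ c : ℝ≥0∞, 0 < c ∧ ∀ k : ℕ, c ≤ ν k U := by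
  have hopen : ∀ (g : Γ) (B : Set X), IsOpen B → IsOpen (g⁻¹ • B) := by
    intro g B hB
    rw [← Set.preimage_smul]
    exact hB.preimage (hcont g)
  have hlist : ∀ l : List Γ, (∀ x ∈ l, 0 < μ {x}) → ∃ K : ℝ≥0∞, K ≠ ⊤ ∧
      ∀ (k : ℕ) (B : Set X), IsOpen B → ν k (l.prod⁻¹ • B) ≤ K * ν k B := by
    intro l
    induction l with
    | nil =>
      intro _
      exact ⟨1, ENNReal.one_ne_top, fun k B _ => by simp⟩
    | cons a l ih =>
      intro hl
      obtain ⟨K, hK, hKB⟩ := ih fun x hx => hl x (List.mem_cons_of_mem _ hx)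
      have ha : 0 < μ {a} := hl a List.mem_cons_self
      have hpos : (1 / 2 : ℝ≥0∞) * μ {a} ≠ 0 := mul_ne_zero (by simp) ha.ne'
      have hfin : (1 / 2 : ℝ≥0∞) * μ {a} ≠ ⊤ :=
        ENNReal.mul_ne_top (by simp) (measure_ne_top μ _)
      refine ⟨K * ((1 / 2 : ℝ≥0∞) * μ {a})⁻¹,
        ENNReal.mul_ne_top hK (ENNReal.inv_ne_top.2 hpos), fun k B hB => ?_⟩
      have h1 : ((1 / 2 : ℝ≥0∞) * μ {a}) * ν k (a⁻¹ • B) ≤ ν k B := by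
        rw [hstat k B hB.measurableSet]
        exact (mul_le_mul_left (hηdom k a) _).trans
          (ENNReal.le_tsum (f := fun g : Γ => η k {g} * ν k (g⁻¹ • B)) a)
      have h2 : ν k (a⁻¹ • B) ≤ ((1 / 2 : ℝ≥0∞) * μ {a})⁻¹ * ν k B := by
        calc ν k (a⁻¹ • B)
            = ((1 / 2 : ℝ≥0∞) * μ {a})⁻¹ * (((1 / 2 : ℝ≥0∞) * μ {a}) * ν k (a⁻¹ • B)) := by
              rw [← mul_assoc, ENNReal.inv_mul_cancel hpos hfin, one_mul]
          _ ≤ _ := by gcongr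
      calc ν k ((a :: l).prod⁻¹ • B) = ν k (l.prod⁻¹ • (a⁻¹ • B)) := by
            rw [List.prod_cons, mul_inv_rev, mul_smul]
        _ ≤ K * ν k (a⁻¹ • B) := hKB k _ (hopen a B hB)
        _ ≤ K * (((1 / 2 : ℝ≥0∞) * μ {a})⁻¹ * ν k B) := by gcongr
        _ = _ := by rw [mul_assoc]
  have hK : ∀ g : Γ, ∃ K : ℝ≥0∞, K ≠ ⊤ ∧ ∀ k : ℕ, ν k (g⁻¹ • U) ≤ K * ν k U := by
    intro g
    obtain ⟨l, hl, rfl⟩ := hgen g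
    obtain ⟨K, h1, h2⟩ := hlist l hl
    exact ⟨K, h1, fun k => h2 k U hUopen⟩
  choose K hKtop hKle using hK
  have hcover : L ⊆ ⋃ g : Γ, g⁻¹ • U := by
    by_contra hcon
    obtain ⟨y, hyL, hy⟩ := Set.not_subset.1 hcon
    have hLmem : ∀ (g : Γ) (x : X), x ∈ L → g • x ∈ L := fun g x hx => by
      have := Set.smul_mem_smul_set (a := g) hx
      rwa [hLinv g] at this
    have hC : ∀ (g : Γ) (x : X), x ∈ L \ (⋃ g : Γ, g⁻¹ • U) →
        g • x ∈ L \ (⋃ g : Γ, g⁻¹ • U) := by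
      rintro g x ⟨hx, hxn⟩
      refine ⟨hLmem g x hx, fun h => hxn ?_⟩
      simp only [Set.mem_iUnion, Set.mem_inv_smul_set_iff] at h ⊢
      obtain ⟨i, hi⟩ := h
      exact ⟨i * g, by rwa [mul_smul]⟩
    have hEq := hmin (L \ ⋃ g : Γ, g⁻¹ • U) Set.diff_subset ⟨y, hyL, hy⟩ (by
        intro g
        ext x
        rw [Set.mem_smul_set_iff_inv_smul_mem]
        refine ⟨fun h => ?_, fun h => hC _ _ h⟩
        have := hC g _ h
        rwa [smul_inv_smul] at this)
      ((hLcomp.isClosed.sdiff (isOpen_iUnion fun g => hopen g U hUopen)).preimage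
        continuous_subtype_val)
    obtain ⟨z, hzU, hzL⟩ := hUL
    rw [← hEq] at hzL
    exact hzL.2 (Set.mem_iUnion.2 ⟨1, by simpa using hzU⟩)
  obtain ⟨F, hF⟩ := hLcomp.elim_finite_subcover _ (fun g => hopen g U hUopen) hcover
  have hS : ∑ g ∈ F, K g ≠ ⊤ := ENNReal.sum_ne_top.2 fun g _ => hKtop g
  refine ⟨(∑ g ∈ F, K g)⁻¹, ENNReal.inv_pos.2 hS, fun k => ?_⟩
  have h1 : 1 ≤ (∑ g ∈ F, K g) * ν k U := by
    calc 1 = ν k L := (hνL k).symm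
      _ ≤ ν k (⋃ g ∈ F, g⁻¹ • U) := measure_mono hF
      _ ≤ ∑ g ∈ F, ν k (g⁻¹ • U) := measure_biUnion_finset_le F _
      _ ≤ ∑ g ∈ F, K g * ν k U := Finset.sum_le_sum fun g _ => hKle g k
      _ = _ := by rw [Finset.sum_mul]
  calc (∑ g ∈ F, K g)⁻¹ = (∑ g ∈ F, K g)⁻¹ * 1 := (mul_one _).symm
    _ ≤ (∑ g ∈ F, K g)⁻¹ * ((∑ g ∈ F, K g) * ν k U) := by gcongr
    _ = ((∑ g ∈ F, K g)⁻¹ * (∑ g ∈ F, K g)) * ν k U := by rw [mul_assoc]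
    _ ≤ 1 * ν k U := by
      gcongr
      exact ENNReal.inv_mul_le_one _
    _ = ν k U := one_mul _
end

section
/- Let Γ be a countable group and μ a probability measure on Γ. Let X be a measurable space with a measurable action of Γ, and let ν be a probability measure on X such that for every g ∈ Γ the pushforward g·ν of ν under the action of g is mutually absolutely continuous with ν, and such that ∑_{g∈Γ} μ({g}) ∫_X |log (d(g⁻¹·ν)/dν)| dν < ∞; set E = −∑_{g∈Γ} μ({g}) ∫_X log (d(g⁻¹·ν)/dν) dν. Let P = μ^{⊗ℤ} be the two-sided Bernoulli measure on Ω = Γ^ℤ and T : Ω → Ω the shift, (Tω)_n = ω_{n+1}. Suppose π : Ω → X is a measurable map which depends only on the coordinates (ω_n)_{n≥1}, whose distribution is ν (i.e. π_*P = ν), and which satisfies π(ω) = ω₁·π(Tω) for P-almost every ω. For n ≥ 1 put y_n(ω) = ω_{−n+1}ω_{−n+2}⋯ω₀ ∈ Γ. Then for every measurable set A ⊆ X with ν(A) > 0, for P-almost every ω one has limsup_{n→∞} [−(1/n) log ν(y_n(ω)·A)] ≤ E. -/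
open MeasureTheory Filter
open scoped Pointwise ENNReal


/-- Running minimum of Birkhoff sums. -/
noncomputable def runMin {Ω : Type*} (S : Ω → Ω) (F : Ω → ℝ) : ℕ → Ω → ℝ
  | 0 => fun _ => 0
  | n + 1 => fun ω => min 0 (F ω + runMin S F n (S ω))

lemma runMin_nonpos {Ω : Type*} (S : Ω → Ω) (F : Ω → ℝ) (n : ℕ) (ω : Ω) :
    runMin S F n ω ≤ 0 := by
  cases n with
  | zero => simp [runMin]
  | succ n => simp [runMin]

lemma runMin_succ_le {Ω : Type*} (S : Ω → Ω) (F : Ω → ℝ) (n : ℕ) (ω : Ω) :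
    runMin S F (n + 1) ω ≤ runMin S F n ω := by
  induction n generalizing ω with
  | zero => simp [runMin]
  | succ n ih =>
    rw [runMin]
    conv_rhs => rw [runMin]
    have := ih (S ω)
    exact min_le_min le_rfl (by linarith)

lemma runMin_le_birkhoffSum {Ω : Type*} (S : Ω → Ω) (F : Ω → ℝ) (n : ℕ) (ω : Ω) :
    runMin S F n ω ≤ birkhoffSum S F n ω := by
  induction n generalizing ω with
  | zero => simp [runMin]
  | succ n ih =>
    rw [runMin, birkhoffSum_succ']
    have := ih (S ω)
    exact (min_le_right _ _).trans (by linarith)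

lemma runMin_measurable {Ω : Type*} [MeasurableSpace Ω] {S : Ω → Ω} {F : Ω → ℝ}
    (hS : Measurable S) (hF : Measurable F) (n : ℕ) : Measurable (runMin S F n) := by
  induction n with
  | zero => exact measurable_const
  | succ n ih => exact measurable_const.min (hF.add (ih.comp hS))

lemma runMin_integrable {Ω : Type*} [MeasurableSpace Ω] {P : Measure Ω} [IsProbabilityMeasure P]
    {S : Ω → Ω} {F : Ω → ℝ} (hS : MeasurePreserving S P P)
    (hi : Integrable F P) (n : ℕ) : Integrable (runMin S F n) P := by
  induction n with
  | zero => exact integrable_const 0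
  | succ n ih =>
    exact (integrable_const (0 : ℝ)).inf (hi.add (hS.integrable_comp_of_integrable ih))

lemma birkhoff_lower_bound {Ω : Type*} [MeasurableSpace Ω] {P : Measure Ω} [IsProbabilityMeasure P]
    {S : Ω → Ω} (hS : MeasurePreserving S P P) (herg : PreErgodic S P) {F : Ω → ℝ}
    (hF : Measurable F) (hi : Integrable F P) (hpos : 0 < ∫ ω, F ω ∂P) :
    ∀ᵐ ω ∂P, ∃ K : ℝ, ∀ n : ℕ, K ≤ birkhoffSum S F n ω := by
  set B : Set Ω := {ω | ∀ K : ℕ, ∃ n, runMin S F n ω < -(K : ℝ)} with hB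
  have hBm : MeasurableSet B := by
    have : B = ⋂ K : ℕ, ⋃ n : ℕ, {ω | runMin S F n ω < -(K : ℝ)} := by
      ext ω; simp [hB]
    rw [this]
    exact MeasurableSet.iInter fun K => MeasurableSet.iUnion fun n =>
      measurableSet_lt (runMin_measurable hS.measurable hF n) measurable_const
  have hBinv : S ⁻¹' B = B := by
    ext ω
    constructor
    · intro h K
      obtain ⟨K', hK'⟩ := exists_nat_ge (K + F ω)
      obtain ⟨n, hn⟩ := h K'
      refine ⟨n + 1, ?_⟩
      rw [runMin]
      exact (min_le_right _ _).trans_lt (by linarith)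
    · intro h K
      obtain ⟨K', hK'⟩ := exists_nat_ge (K - F ω)
      obtain ⟨n, hn⟩ := h K'
      have h0 : (0 : ℝ) ≤ K' := Nat.cast_nonneg _
      cases n with
      | zero => simp only [runMin] at hn; linarith
      | succ n =>
        rw [runMin] at hn
        refine ⟨n, ?_⟩
        rcases min_lt_iff.1 hn with h1 | h1
        · linarith
        · linarith
  rcases herg.prob_eq_zero_or_one hBm hBinv with h | h
  · have : ∀ᵐ ω ∂P, ω ∉ B := measure_eq_zero_iff_ae_notMem.1 h
    filter_upwards [this] with ω hω
    simp only [hB, Set.mem_ofPred_eq, not_forall, not_exists, not_lt] at hω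
    obtain ⟨K, hK⟩ := hω
    exact ⟨-K, fun n => (hK n).trans (runMin_le_birkhoffSum S F n ω)⟩
  · exfalso
    have hae : ∀ᵐ ω ∂P, ω ∈ B := by
      rw [← prob_compl_eq_zero_iff hBm] at h
      exact mem_ae_iff.2 h
    set D : ℕ → Ω → ℝ := fun n ω => runMin S F (n + 1) ω - runMin S F n (S ω) with hD
    have hDeq : ∀ n ω, D n ω = min (-runMin S F n (S ω)) (F ω) := by
      intro n ω
      simp only [hD, runMin]
      rw [← min_sub_sub_right]; congr 1 <;> ring
    have hDint : ∀ n, ∫ ω, D n ω ∂P ≤ 0 := by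
      intro n
      have i1 := runMin_integrable hS hi (n + 1)
      have i2 := runMin_integrable hS hi n
      have i3 : Integrable (fun ω => runMin S F n (S ω)) P := hS.integrable_comp_of_integrable i2
      have e : ∫ ω, runMin S F n (S ω) ∂P = ∫ ω, runMin S F n ω ∂P := by
        conv_rhs => rw [← hS.map_eq]
        rw [integral_map hS.measurable.aemeasurable
          (runMin_measurable hS.measurable hF n).aestronglyMeasurable]
      simp only [hD]
      rw [integral_sub i1 i3, e]
      have := integral_mono i1 i2 (fun ω => runMin_succ_le S F n ω)
      simpa using this
    have hlim : Tendsto (fun n => ∫ ω, D n ω ∂P) atTop (nhds (∫ ω, F ω ∂P)) := by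
      refine tendsto_integral_of_dominated_convergence (fun ω => |F ω|) ?_ hi.abs ?_ ?_
      · intro n
        exact ((runMin_measurable hS.measurable hF (n + 1)).sub
          ((runMin_measurable hS.measurable hF n).comp hS.measurable)).aestronglyMeasurable
      · intro n
        refine Eventually.of_forall fun ω => ?_
        rw [hDeq, Real.norm_eq_abs]
        have := runMin_nonpos S F n (S ω)
        rcases min_cases (-runMin S F n (S ω)) (F ω) with ⟨h1, h2⟩ | ⟨h1, h2⟩
        · rw [h1, abs_of_nonneg (by linarith)]; exact h2.trans (le_abs_self _)
        · rw [h1]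
      · filter_upwards [hae] with ω hω
        rw [← hBinv] at hω
        obtain ⟨K, hK⟩ := exists_nat_ge (F ω)
        obtain ⟨n, hn⟩ := hω K
        refine tendsto_const_nhds.congr' ?_
        filter_upwards [eventually_ge_atTop n] with m hm
        have := antitone_nat_of_succ_le (f := fun n => runMin S F n (S ω))
          (fun n => runMin_succ_le S F n (S ω)) hm
        simp only at this
        rw [hDeq, min_eq_right (by linarith)]
    have := le_of_tendsto' hlim hDint
    linarith

/-- sigma-algebra generated by a family of coordinates -/
abbrev coordSigma (Γ : Type*) [MeasurableSpace Γ] (I : Set ℤ) : MeasurableSpace (ℤ → Γ) :=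
  ⨆ i ∈ I, MeasurableSpace.comap (fun ω : ℤ → Γ => ω i) inferInstance

lemma coord_measurable {Γ : Type*} [MeasurableSpace Γ] {I : Set ℤ} {i : ℤ} (hi : i ∈ I) :
    Measurable[coordSigma Γ I] (fun ω : ℤ → Γ => ω i) := by
  have : MeasurableSpace.comap (fun ω : ℤ → Γ => ω i) inferInstance ≤ coordSigma Γ I :=
    le_iSup₂_of_le i hi le_rfl
  exact (comap_measurable _).mono this le_rfl

lemma indep_coord {Γ : Type*} [MeasurableSpace Γ] {μ : Measure Γ} [IsProbabilityMeasure μ]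
    {I J : Set ℤ} (hIJ : Disjoint I J) :
    ProbabilityTheory.Indep (coordSigma Γ I) (coordSigma Γ J)
      (Measure.infinitePi (fun _ : ℤ => μ)) := by
  refine ProbabilityTheory.indep_iSup_of_disjoint
    (fun i => (measurable_pi_apply i).comap_le) ?_ hIJ
  exact ProbabilityTheory.iIndepFun_infinitePi (P := fun _ : ℤ => μ) (X := fun _ x => x)
    (fun _ => measurable_id)

/-- backward shift -/
def bshift {Γ : Type*} (ω : ℤ → Γ) : ℤ → Γ := fun n => ω (n - 1)

lemma bshift_iterate {Γ : Type*} (n : ℕ) (ω : ℤ → Γ) (m : ℤ) :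
    bshift^[n] ω m = ω (m - n) := by
  induction n generalizing ω with
  | zero => simp
  | succ n ih =>
    rw [Function.iterate_succ_apply, ih]
    simp only [bshift]
    congr 1; push_cast; ring

lemma bshift_mp {Γ : Type*} [MeasurableSpace Γ] {μ : Measure Γ} [IsProbabilityMeasure μ] :
    MeasurePreserving (bshift (Γ := Γ)) (Measure.infinitePi (fun _ : ℤ => μ))
      (Measure.infinitePi (fun _ : ℤ => μ)) := by
  refine ⟨measurable_pi_iff.2 fun n => measurable_pi_apply _, ?_⟩
  exact Measure.map_infinitePi_infinitePi_of_inj (P := fun _ : ℤ => μ) (f := fun n : ℤ => n - 1)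
    (fun a b h => by simpa using h)

lemma bshift_ergodic {Γ : Type*} [MeasurableSpace Γ] {μ : Measure Γ} [IsProbabilityMeasure μ] :
    PreErgodic (bshift (Γ := Γ)) (Measure.infinitePi (fun _ : ℤ => μ)) := by
  set P := Measure.infinitePi (fun _ : ℤ => μ) with hPdef
  constructor
  intro B hB hinv
  have key : P.real B = P.real B * P.real B := by
    refine eq_of_forall_dist_le fun ε hε => ?_
    obtain ⟨C, hC, hCB⟩ := exists_measure_symmDiff_lt_of_generateFrom_isSetRing (μ := P)
      (C := measurableCylinders (fun _ : ℤ => Γ)) isSetRing_measurableCylinders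
      ⟨{Set.univ}, Set.countable_singleton _, 
        Set.singleton_subset_iff.2 (univ_mem_measurableCylinders _), by simp⟩
      generateFrom_measurableCylinders.symm hB (ε := ENNReal.ofReal (ε / 4)) (by simp; positivity)
    have hd : P.real (symmDiff C B) ≤ ε / 4 := by
      rw [Measure.real]
      exact ENNReal.toReal_le_of_le_ofReal (by positivity) hCB.le
    obtain ⟨I, T, hT, rfl⟩ := (mem_measurableCylinders _).1 hC
    have hCm : MeasurableSet (cylinder I T) := 
      Finset.measurable_restrict (X := fun _ : ℤ => Γ) I hT
    -- choose the shift
    obtain ⟨N, hN⟩ : ∃ N : ℕ, ∀ i ∈ I, ∀ j ∈ I, i - j < N := by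
      obtain ⟨N, hN⟩ := ((I ×ˢ I).image fun p => (p.1 - p.2).toNat).exists_nat_subset_range
      refine ⟨N, fun i hi j hj => ?_⟩
      have : (i - j).toNat ∈ Finset.range N := hN (Finset.mem_image.2
        ⟨(i, j), Finset.mk_mem_product hi hj, rfl⟩)
      rw [Finset.mem_range] at this
      omega
    set C := cylinder (α := fun _ : ℤ => Γ) I T with hCdef
    set C' := bshift^[N] ⁻¹' C with hC'
    have hmpN := (bshift_mp (μ := μ)).iterate N
    have hind : P (C ∩ C') = P C * P C' := by
      have hdis : Disjoint (I : Set ℤ) ((fun i : ℤ => i - N) '' (I : Set ℤ)) := by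
        rw [Set.disjoint_left]
        rintro i hi ⟨j, hj, hji⟩
        have := hN j hj i hi
        simp only at hji
        omega
      have h := indep_coord (μ := μ) hdis
      rw [ProbabilityTheory.Indep_iff] at h
      refine h C C' ?_ ?_
      · have : Measurable[coordSigma Γ I] (fun ω : ℤ → Γ => I.restrict ω) := by
          refine @measurable_pi_lambda _ _ _ (_) _ _ fun i => ?_
          exact coord_measurable i.2
        exact this hT
      · have : Measurable[coordSigma Γ ((fun i : ℤ => i - N) '' (I : Set ℤ))]
            (fun ω : ℤ → Γ => I.restrict (bshift^[N] ω)) := by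
          refine @measurable_pi_lambda _ _ _ (_) _ _ fun i => ?_
          simp only [Finset.restrict, bshift_iterate]
          exact coord_measurable ⟨i, i.2, rfl⟩
        exact this hT
    have hC'P : P C' = P C := hmpN.measure_preimage hCm.nullMeasurableSet
    have hB' : bshift^[N] ⁻¹' B = B := by
      rw [Set.preimage_iterate_eq]
      exact Function.iterate_fixed hinv N
    have hCC : P.real (C ∩ C') = P.real C * P.real C := by
      simp only [Measure.real, hind, hC'P, ENNReal.toReal_mul]
    have hd' : P.real (symmDiff C' B) ≤ ε / 4 := by
      have : symmDiff C' B = bshift^[N] ⁻¹' (symmDiff C B) := by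
        conv_lhs => rw [← hB', hC']
        simp [symmDiff_def]
      rw [this, Measure.real, hmpN.measure_preimage (hCm.symmDiff hB).nullMeasurableSet]
      exact hd
    have h1 : |P.real C - P.real B| ≤ ε / 4 :=
      (abs_measureReal_sub_le_measureReal_symmDiff hCm.nullMeasurableSet hB.nullMeasurableSet).trans hd
    have h2 : |P.real (C ∩ C') - P.real B| ≤ ε / 2 := by
      refine (abs_measureReal_sub_le_measureReal_symmDiff
        (hCm.inter (hmpN.measurable hCm)).nullMeasurableSet hB.nullMeasurableSet).trans ?_
      have hsub : symmDiff (C ∩ C') B ⊆ symmDiff C B ∪ symmDiff C' B := by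
        intro x
        simp only [Set.mem_symmDiff, Set.mem_union, Set.mem_inter_iff]
        tauto
      calc _ ≤ P.real (symmDiff C B ∪ symmDiff C' B) := measureReal_mono hsub
        _ ≤ _ := measureReal_union_le _ _
        _ ≤ _ := by linarith
    rw [hCC] at h2
    have b1 : P.real C ≤ 1 := measureReal_le_one
    have b2 : P.real B ≤ 1 := measureReal_le_one
    have b3 : 0 ≤ P.real C := measureReal_nonneg
    have b4 : 0 ≤ P.real B := measureReal_nonneg
    rw [Real.dist_eq]
    rw [abs_le] at *
    constructor <;> nlinarith
  have h01 : P.real B = 0 ∨ P.real B = 1 := by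
    have : P.real B * (P.real B - 1) = 0 := by linarith
    rcases mul_eq_zero.1 this with h | h
    · exact Or.inl h
    · exact Or.inr (by linarith)
  rw [eventuallyConst_set']
  rcases h01 with h | h
  · left
    rw [measureReal_eq_zero_iff] at h
    exact ae_eq_empty.2 h
  · right
    rw [ae_eq_univ, prob_compl_eq_zero_iff hB]
    rw [Measure.real] at h
    rw [← ENNReal.ofReal_toReal (measure_ne_top P B), h]; simp

section cocycle

variable {Γ X : Type*} [Group Γ] [MeasurableSpace X] [MulAction Γ X]

/-- the Radon-Nikodym cocycle -/
noncomputable def rnc (Γ : Type*) {X : Type*} [Group Γ] [MeasurableSpace X] [MulAction Γ X]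
    (ν : Measure X) (g : Γ) (x : X) : ℝ≥0∞ :=
  ((Measure.map (fun x : X => g⁻¹ • x) ν).rnDeriv ν) x

lemma rnc_measurable (ν : Measure X) (g : Γ) : Measurable (rnc Γ ν g) :=
  Measure.measurable_rnDeriv _ _

lemma rnc_one (ν : Measure X) [IsProbabilityMeasure ν] :
    ∀ᵐ x ∂ν, rnc Γ ν 1 x = 1 := by
  have : Measure.map (fun x : X => (1 : Γ)⁻¹ • x) ν = ν := by simp
  simp only [rnc, this]
  exact ν.rnDeriv_self

lemma setLIntegral_rnc (hmeas : ∀ g : Γ, Measurable fun x : X => g • x)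
    (ν : Measure X) [IsProbabilityMeasure ν]
    (hqi : ∀ g : Γ, Measure.map (fun x : X => g • x) ν ≪ ν)
    (g : Γ) {A : Set X} (hA : MeasurableSet A) :
    ∫⁻ x in A, rnc Γ ν g x ∂ν = ν (g • A) := by
  have := Measure.isProbabilityMeasure_map (μ := ν) (hmeas g⁻¹).aemeasurable
  simp only [rnc]
  rw [Measure.setLIntegral_rnDeriv (hqi g⁻¹), Measure.map_apply (hmeas _) hA,
    Set.preimage_smul_inv]

lemma rnc_mul (hmeas : ∀ g : Γ, Measurable fun x : X => g • x)
    (ν : Measure X) [IsProbabilityMeasure ν]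
    (hqi : ∀ g : Γ, Measure.map (fun x : X => g • x) ν ≪ ν) (g h : Γ) :
    ∀ᵐ x ∂ν, rnc Γ ν (g * h) x = rnc Γ ν g (h • x) * rnc Γ ν h x := by
  have := Measure.isProbabilityMeasure_map (μ := ν) (hmeas h⁻¹).aemeasurable
  have hm : Measurable (fun x => rnc Γ ν g (h • x) * rnc Γ ν h x) :=
    ((rnc_measurable ν g).comp (hmeas h)).mul (rnc_measurable ν h)
  have := Measure.eq_rnDeriv (μ := Measure.map (fun x : X => (g * h)⁻¹ • x) ν) (ν := ν) (s := 0)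
    hm Measure.MutuallySingular.zero_left ?_
  · filter_upwards [this] with x hx
    rw [hx]; rfl
  · rw [zero_add]
    ext A hA
    rw [withDensity_apply _ hA, ← lintegral_indicator hA]
    have e1 : ∀ x, A.indicator (fun x => rnc Γ ν g (h • x) * rnc Γ ν h x) x
        = rnc Γ ν h x * A.indicator (fun x => rnc Γ ν g (h • x)) x := by
      intro x
      by_cases hx : x ∈ A <;> simp [hx, mul_comm]
    have hm2 : Measurable (A.indicator (fun x => rnc Γ ν g (h • x))) :=
      ((rnc_measurable ν g).comp (hmeas h)).indicator hA
    simp_rw [e1]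
    simp only [rnc] at hm2 ⊢
    rw [lintegral_rnDeriv_mul (hqi h⁻¹) hm2.aemeasurable, lintegral_map hm2 (hmeas _)]
    have e2 : ∀ y, A.indicator (fun x => (Measure.map (fun x : X => g⁻¹ • x) ν).rnDeriv ν (h • x))
        (h⁻¹ • y) = (h • A).indicator (fun y => rnc Γ ν g y) y := by
      intro y
      by_cases hy : y ∈ h • A
      · have : h⁻¹ • y ∈ A := Set.mem_smul_set_iff_inv_smul_mem.1 hy
        simp [hy, this, rnc]
      · have : h⁻¹ • y ∉ A := fun h' => hy (Set.mem_smul_set_iff_inv_smul_mem.2 h')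
        simp [hy, this]
    simp_rw [e2]
    have hhA : MeasurableSet (h • A) := by
      rw [← Set.preimage_smul_inv]; exact hmeas _ hA
    rw [lintegral_indicator hhA, setLIntegral_rnc hmeas ν hqi g hhA,
      Measure.map_apply (hmeas _) hA, Set.preimage_smul_inv, mul_smul]

lemma rnc_pos_fin (hmeas : ∀ g : Γ, Measurable fun x : X => g • x)
    (ν : Measure X) [IsProbabilityMeasure ν]
    (hqi : ∀ g : Γ, Measure.map (fun x : X => g • x) ν ≪ ν ∧
      ν ≪ Measure.map (fun x : X => g • x) ν) (g : Γ) :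
    ∀ᵐ x ∂ν, 0 < rnc Γ ν g x ∧ rnc Γ ν g x ≠ ⊤ := by
  have := Measure.isProbabilityMeasure_map (μ := ν) (hmeas g⁻¹).aemeasurable
  have h1 := (hqi g⁻¹).2.ae_le (Measure.rnDeriv_pos (hqi g⁻¹).1)
  have h2 := Measure.rnDeriv_ne_top (Measure.map (fun x : X => g⁻¹ • x) ν) ν
  filter_upwards [h1, h2] with x h1 h2
  exact ⟨h1, h2⟩

end cocycle

section main

variable {Γ X : Type*} [Group Γ] [Countable Γ] [MeasurableSpace Γ] [MeasurableSingletonClass Γ]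
    [MeasurableSpace X] [MulAction Γ X]

lemma rnc_measurable_uncurry (ν : Measure X) :
    Measurable (fun p : Γ × X => rnc Γ ν p.1 p.2) :=
  measurable_from_prod_countable_right fun g => rnc_measurable ν g

lemma log_rnc_integrable (μ : Measure Γ) [IsProbabilityMeasure μ]
    (ν : Measure X) [IsProbabilityMeasure ν]
    (hint : ∀ g : Γ, μ {g} ≠ 0 → Integrable (fun x => Real.log (rnc Γ ν g x).toReal) ν)
    (hsum : Summable fun g : Γ => (μ {g}).toReal *
      ∫ x, |Real.log (rnc Γ ν g x).toReal| ∂ν) :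
    Integrable (fun p : Γ × X => Real.log (rnc Γ ν p.1 p.2).toReal) (μ.prod ν) ∧
    ∫ p, Real.log (rnc Γ ν p.1 p.2).toReal ∂(μ.prod ν) =
      ∑' g : Γ, (μ {g}).toReal * ∫ x, Real.log (rnc Γ ν g x).toReal ∂ν := by
  have hm : Measurable (fun p : Γ × X => Real.log (rnc Γ ν p.1 p.2).toReal) :=
    Real.measurable_log.comp (rnc_measurable_uncurry ν).ennreal_toReal
  have hI : Integrable (fun p : Γ × X => Real.log (rnc Γ ν p.1 p.2).toReal) (μ.prod ν) := by
    rw [integrable_prod_iff hm.aestronglyMeasurable]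
    refine ⟨ae_iff_of_countable.2 hint, ?_⟩
    rw [← Measure.sum_smul_dirac μ]
    refine integrable_sum_measure (fun g => ?_) ?_
    · refine Integrable.smul_measure ?_ (measure_ne_top μ _)
      exact integrable_dirac (by simp)
    · refine hsum.congr fun g => ?_
      rw [integral_smul_measure, integral_dirac, smul_eq_mul]
      simp only [Real.norm_eq_abs]
      rw [abs_of_nonneg (integral_nonneg fun x => abs_nonneg _)]
  refine ⟨hI, ?_⟩
  rw [integral_prod _ hI, integral_countable hI.integral_prod_left]
  simp [Measure.real]

/-- the product `ω_{-n+1} ⋯ ω_0` -/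
def pastProd (n : ℕ) (ω : ℤ → Γ) : Γ :=
  ((List.range n).map fun i : ℕ => ω (1 - (n : ℤ) + i)).prod

lemma pastProd_succ (n : ℕ) (ω : ℤ → Γ) : pastProd (n + 1) ω = ω (-n) * pastProd n ω := by
  rw [pastProd, List.range_succ_eq_map, List.map_cons, List.prod_cons, List.map_map, pastProd]
  congr 1
  · congr 1; push_cast; ring
  · congr 2
    funext i
    simp only [Function.comp]
    congr 1; push_cast; ring

lemma pastProd_measurable (n : ℕ) : Measurable (pastProd (Γ := Γ) n) := by
  induction n with
  | zero => exact measurable_const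
  | succ n ih =>
    have : pastProd (Γ := Γ) (n + 1) = fun ω => ω (-n) * pastProd n ω := by
      funext ω; exact pastProd_succ n ω
    rw [this]
    have h2 : Measurable (fun p : Γ × Γ => p.1 * p.2) := measurable_of_countable _
    exact h2.comp ((measurable_pi_apply _).prodMk ih)

lemma pastProd_congr (n : ℕ) (ω ω' : ℤ → Γ) (h : ∀ i : ℤ, i ≤ 0 → ω i = ω' i) :
    pastProd n ω = pastProd n ω' := by
  induction n with
  | zero => rfl
  | succ n ih => rw [pastProd_succ, pastProd_succ, ih, h _ (by omega)]

/-- keep only the coordinates in the past -/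
def keepPast (ω : ℤ → Γ) : ℤ → Γ := fun i => if i ≤ 0 then ω i else 1

/-- keep only the coordinates in the future -/
def keepFut (ω : ℤ → Γ) : ℤ → Γ := fun i => if 1 ≤ i then ω i else 1

lemma keepPast_measurable : Measurable[coordSigma Γ (Set.Iic 0)] (keepPast (Γ := Γ)) := by
  refine @measurable_pi_lambda _ _ _ (_) _ _ fun i => ?_
  by_cases hi : i ≤ 0
  · simp only [keepPast, hi, if_true]
    exact coord_measurable hi
  · simp only [keepPast, hi, if_false]
    exact @measurable_const _ _ _ (_) _

lemma keepFut_measurable : Measurable[coordSigma Γ (Set.Ici 1)] (keepFut (Γ := Γ)) := by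
  refine @measurable_pi_lambda _ _ _ (_) _ _ fun i => ?_
  by_cases hi : 1 ≤ i
  · simp only [keepFut, hi, if_true]
    exact coord_measurable hi
  · simp only [keepFut, hi, if_false]
    exact @measurable_const _ _ _ (_) _

lemma keepPast_measurable' : Measurable (keepPast (Γ := Γ)) := by
  refine measurable_pi_lambda _ fun i => ?_
  by_cases hi : i ≤ 0
  · simp only [keepPast, hi, if_true]; fun_prop
  · simp only [keepPast, hi, if_false]; fun_prop

/-- past and `π` are independent -/
lemma map_keepPast_prod {μ : Measure Γ} [IsProbabilityMeasure μ] {ν : Measure X}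
    {π : (ℤ → Γ) → X} (hπmeas : Measurable π)
    (hπdep : ∀ ω ω' : ℤ → Γ, (∀ n : ℤ, 1 ≤ n → ω n = ω' n) → π ω = π ω')
    (hπdist : Measure.map π (Measure.infinitePi (fun _ : ℤ => μ)) = ν) :
    Measure.map (fun ω => (keepPast ω, π ω)) (Measure.infinitePi (fun _ : ℤ => μ)) =
      (Measure.map keepPast (Measure.infinitePi (fun _ : ℤ => μ))).prod ν := by
  rw [← hπdist]
  rw [← ProbabilityTheory.indepFun_iff_map_prod_eq_prod_map_map
    keepPast_measurable'.aemeasurable hπmeas.aemeasurable]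
  rw [ProbabilityTheory.IndepFun_iff_Indep]
  have hd : Disjoint (Set.Iic (0 : ℤ)) (Set.Ici 1) := by
    rw [Set.disjoint_left]; intro i h1 h2
    simp only [Set.mem_Iic, Set.mem_Ici] at h1 h2; omega
  refine ProbabilityTheory.indep_of_indep_of_le_left (ProbabilityTheory.indep_of_indep_of_le_right
    (indep_coord (μ := μ) hd) ?_) ?_
  · have : π = π ∘ keepFut := by
      funext ω
      exact hπdep _ _ fun n hn => by simp [keepFut, hn]
    rw [this]
    exact Measurable.comap_le (hπmeas.comp keepFut_measurable)
  · exact Measurable.comap_le keepPast_measurable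

/-- Along the orbit, the cocycle is the exponential of a Birkhoff sum. -/
lemma rnc_pastProd_eq (hmeas : ∀ g : Γ, Measurable fun x : X => g • x)
    (μ : Measure Γ) [IsProbabilityMeasure μ]
    (ν : Measure X) [IsProbabilityMeasure ν]
    (hqi : ∀ g : Γ, Measure.map (fun x : X => g • x) ν ≪ ν ∧
      ν ≪ Measure.map (fun x : X => g • x) ν)
    {P : Measure (ℤ → Γ)} (hP : P = Measure.infinitePi (fun _ : ℤ => μ))
    (π : (ℤ → Γ) → X) (hπmeas : Measurable π)
    (hπdist : Measure.map π P = ν)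
    (hπequiv : ∀ᵐ ω ∂P, π ω = ω 1 • π (fun n => ω (n + 1))) :
    ∀ᵐ ω ∂P, ∀ n : ℕ, rnc Γ ν (pastProd n ω) (π ω) = ENNReal.ofReal (Real.exp
      (birkhoffSum bshift (fun ω => Real.log (rnc Γ ν (ω 0) (π ω)).toReal) n ω)) := by
  have hS : MeasurePreserving (bshift (Γ := Γ)) P P := by rw [hP]; exact bshift_mp
  have hπ : ∀ p : X → Prop, (∀ᵐ x ∂ν, p x) → ∀ᵐ ω ∂P, p (π ω) := by
    intro p hp
    rw [← hπdist] at hp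
    exact ae_of_ae_map hπmeas.aemeasurable hp
  have a1 : ∀ᵐ ω ∂P, ∀ n : ℕ, π (bshift^[n + 1] ω) = ω (-n) • π (bshift^[n] ω) := by
    rw [ae_all_iff]
    intro n
    have := (hS.iterate (n + 1)).quasiMeasurePreserving.ae hπequiv
    filter_upwards [this] with ω hω
    rw [hω, bshift_iterate]
    congr 2
    · push_cast; ring
    · funext m
      rw [bshift_iterate, bshift_iterate]; congr 1; push_cast; ring
  have a2 : ∀ᵐ ω ∂P, ∀ g h : Γ, rnc Γ ν (g * h) (π ω) =
      rnc Γ ν g (h • π ω) * rnc Γ ν h (π ω) := by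
    rw [ae_all_iff]; intro g
    rw [ae_all_iff]; intro h
    exact hπ _ (rnc_mul hmeas ν (fun g => (hqi g).1) g h)
  have a3 := hπ _ (rnc_one (Γ := Γ) ν)
  have a4 : ∀ᵐ ω ∂P, ∀ n : ℕ, ∀ g : Γ, 0 < rnc Γ ν g (π (bshift^[n] ω)) ∧
      rnc Γ ν g (π (bshift^[n] ω)) ≠ ⊤ := by
    rw [ae_all_iff]; intro n
    rw [ae_all_iff]; intro g
    exact (hS.iterate n).quasiMeasurePreserving.ae (hπ _ (rnc_pos_fin hmeas ν hqi g))
  filter_upwards [a1, a2, a3, a4] with ω h1 h2 h3 h4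
  have hy : ∀ n, pastProd n ω • π ω = π (bshift^[n] ω) := by
    intro n
    induction n with
    | zero => simp [pastProd]
    | succ n ih => rw [pastProd_succ, mul_smul, ih, h1 n]
  intro n
  induction n with
  | zero => simpa [pastProd] using h3
  | succ n ih =>
    rw [pastProd_succ, h2, ih, hy, birkhoffSum_succ, add_comm, Real.exp_add,
      ENNReal.ofReal_mul (Real.exp_pos _).le, bshift_iterate]
    congr 1
    obtain ⟨hp, hf⟩ := h4 n (ω (-n))
    simp only [zero_sub]
    rw [Real.exp_log (ENNReal.toReal_pos hp.ne' hf), ENNReal.ofReal_toReal hf]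

lemma main_aux (hmeas : ∀ g : Γ, Measurable fun x : X => g • x)
    (μ : Measure Γ) [IsProbabilityMeasure μ]
    (ν : Measure X) [IsProbabilityMeasure ν]
    (hqi : ∀ g : Γ, Measure.map (fun x : X => g • x) ν ≪ ν ∧
      ν ≪ Measure.map (fun x : X => g • x) ν)
    (hint : ∀ g : Γ, μ {g} ≠ 0 → Integrable (fun x => Real.log (rnc Γ ν g x).toReal) ν)
    (hsum : Summable fun g : Γ => (μ {g}).toReal *
      ∫ x, |Real.log (rnc Γ ν g x).toReal| ∂ν)
    (E : ℝ)
    (hE : E = -∑' g : Γ, (μ {g}).toReal * ∫ x, Real.log (rnc Γ ν g x).toReal ∂ν)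
    (P : Measure (ℤ → Γ)) [IsProbabilityMeasure P]
    (hP : P = Measure.infinitePi (fun _ : ℤ => μ))
    (π : (ℤ → Γ) → X) (hπmeas : Measurable π)
    (hπdep : ∀ ω ω' : ℤ → Γ, (∀ n : ℤ, 1 ≤ n → ω n = ω' n) → π ω = π ω')
    (hπdist : Measure.map π P = ν)
    (hπequiv : ∀ᵐ ω ∂P, π ω = ω 1 • π (fun n => ω (n + 1)))
    (A : Set X) (hA : MeasurableSet A) (hApos : 0 < ν A) (ε : ℝ) (hε : 0 < ε) :
    ∀ᵐ ω ∂P, ∀ᶠ n : ℕ in atTop,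
      -(1 / (n : ℝ)) * Real.log (ν (pastProd n ω • A)).toReal ≤ E + 2 * ε := by
  have hS : MeasurePreserving (bshift (Γ := Γ)) P P := by rw [hP]; exact bshift_mp
  have hjoint := map_keepPast_prod (μ := μ) hπmeas hπdep (hP ▸ hπdist)
  rw [← hP] at hjoint
  obtain ⟨hI, hIeq⟩ := log_rnc_integrable μ ν hint hsum
  -- law of (ω 0, π ω)
  have hlaw : Measure.map (fun ω : ℤ → Γ => (ω 0, π ω)) P = μ.prod ν := by
    have e : (fun ω : ℤ → Γ => (ω 0, π ω)) =
        (Prod.map (fun u : ℤ → Γ => u 0) id) ∘ fun ω => (keepPast ω, π ω) := by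
      funext ω; simp [keepPast]
    rw [e, ← Measure.map_map ((measurable_pi_apply 0).prodMap measurable_id)
      (keepPast_measurable'.prodMk hπmeas), hjoint]
    have := Measure.isProbabilityMeasure_map (μ := P) (keepPast_measurable' (Γ := Γ)).aemeasurable
    rw [← Measure.map_prod_map _ _ (measurable_pi_apply 0) measurable_id, Measure.map_id,
      Measure.map_map (measurable_pi_apply 0) keepPast_measurable']
    congr 1
    have e2 : (fun u : ℤ → Γ => u 0) ∘ keepPast = fun u : ℤ → Γ => u 0 := by
      funext u; simp [keepPast]
    rw [e2, hP]
    exact Measure.infinitePi_map_eval (fun _ : ℤ => μ) 0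
  set F : (ℤ → Γ) → ℝ := fun ω => Real.log (rnc Γ ν (ω 0) (π ω)).toReal with hF
  have hpair : Measurable (fun ω : ℤ → Γ => (ω 0, π ω)) := (measurable_pi_apply 0).prodMk hπmeas
  have hFm : Measurable F :=
    Real.measurable_log.comp ((rnc_measurable_uncurry ν).ennreal_toReal.comp hpair)
  have hFi : Integrable F P := by
    rw [← hlaw] at hI
    exact hI.comp_measurable hpair
  have hFint : ∫ ω, F ω ∂P = -E := by
    rw [hE, neg_neg, ← hIeq, ← hlaw, integral_map hpair.aemeasurable]
    rw [hlaw]; exact hI.aestronglyMeasurable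
  have hbd := birkhoff_lower_bound hS (hP ▸ bshift_ergodic) (F := fun ω => F ω + (E + ε))
    (hFm.add_const _) (hFi.add (integrable_const _)) (by
      rw [integral_add hFi (integrable_const _), hFint]; simp [hε])
  have hsumeq : ∀ n ω, birkhoffSum bshift (fun ω => F ω + (E + ε)) n ω =
      birkhoffSum bshift F n ω + n * (E + ε) := by
    intro n ω
    simp [birkhoffSum, Finset.sum_add_distrib]
    ring
  have hco := rnc_pastProd_eq hmeas μ ν hqi hP π hπmeas hπdist hπequiv
  set c : ℝ := E + 2 * ε with hc
  set Q : (ℤ → Γ) × X → Prop := fun p => liminf (fun n : ℕ => rnc Γ ν (pastProd n p.1) p.2 *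
    ENNReal.ofReal (Real.exp (n * c))) atTop = ⊤ with hQ
  have hQm : MeasurableSet {p | Q p} := by
    refine measurableSet_eq_fun (Measurable.liminf fun n => ?_) measurable_const
    refine Measurable.mul_const ?_ _
    exact (rnc_measurable_uncurry ν).comp
      (((pastProd_measurable n).comp measurable_fst).prodMk measurable_snd)
  have hQpast : ∀ ω x, Q (keepPast ω, x) ↔ Q (ω, x) := by
    intro ω x
    have : ∀ n, pastProd n (keepPast ω) = pastProd n ω := fun n =>
      pastProd_congr n _ _ fun i hi => by simp [keepPast, hi]
    simp only [hQ, this]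
  have hQae : ∀ᵐ ω ∂P, Q (keepPast ω, π ω) := by
    filter_upwards [hbd, hco] with ω ⟨K, hK⟩ hω
    rw [hQpast]
    simp only [hQ]
    refine Tendsto.liminf_eq ?_
    have hle : ∀ n : ℕ, ENNReal.ofReal (Real.exp (K + n * ε)) ≤
        rnc Γ ν (pastProd n ω) (π ω) * ENNReal.ofReal (Real.exp (n * c)) := by
      intro n
      rw [hω n, ← ENNReal.ofReal_mul (Real.exp_pos _).le, ← Real.exp_add]
      refine ENNReal.ofReal_le_ofReal (Real.exp_le_exp.2 ?_)
      have := hK n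
      rw [hsumeq] at this
      rw [hc]
      linarith
    refine tendsto_nhds_top_mono' ?_ hle
    refine ENNReal.tendsto_ofReal_atTop.comp (Real.tendsto_exp_atTop.comp ?_)
    exact tendsto_atTop_add_const_left _ _ (tendsto_natCast_atTop_atTop.atTop_mul_const hε)
  have hQprod : ∀ᵐ p ∂((Measure.map keepPast P).prod ν), Q p := by
    rw [← hjoint, ae_map_iff (keepPast_measurable'.prodMk hπmeas).aemeasurable hQm]
    exact hQae
  have h3 := ae_of_ae_map keepPast_measurable'.aemeasurable (Measure.ae_ae_of_ae_prod hQprod)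
  filter_upwards [h3] with ω hω
  have hω' : ∀ᵐ x ∂(ν.restrict A), liminf (fun n : ℕ => rnc Γ ν (pastProd n ω) x *
      ENNReal.ofReal (Real.exp (n * c))) atTop = ⊤ := by
    refine ae_restrict_of_ae ?_
    filter_upwards [hω] with x hx
    exact (hQpast ω x).1 hx
  have hfatou := lintegral_liminf_le (μ := ν.restrict A) (u := atTop)
    (f := fun (n : ℕ) x => rnc Γ ν (pastProd n ω) x * ENNReal.ofReal (Real.exp (n * c)))
    (fun n => (rnc_measurable ν _).mul_const _)
  rw [lintegral_congr_ae hω', lintegral_const, Measure.restrict_apply_univ,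
    ENNReal.top_mul hApos.ne', top_le_iff] at hfatou
  have hev := eventually_lt_of_lt_liminf (f := atTop) (b := (1 : ℝ≥0∞)) (by
    rw [hfatou]; exact ENNReal.one_lt_top)
  filter_upwards [hev, eventually_ge_atTop 1] with n hn hn1
  rw [lintegral_mul_const _ (rnc_measurable ν _),
    setLIntegral_rnc hmeas ν (fun g => (hqi g).1) _ hA] at hn
  set v := ν (pastProd n ω • A)
  have hvt : v ≠ ⊤ := measure_ne_top _ _
  have h1 : 1 < v.toReal * Real.exp (n * c) := by
    have h := (ENNReal.toReal_lt_toReal ENNReal.one_ne_top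
      (ENNReal.mul_ne_top hvt ENNReal.ofReal_ne_top)).2 hn
    rwa [ENNReal.toReal_mul, ENNReal.toReal_ofReal (Real.exp_pos _).le, ENNReal.toReal_one] at h
  have hv0 : 0 < v.toReal := by
    by_contra h
    have : v.toReal = 0 := le_antisymm (not_lt.1 h) ENNReal.toReal_nonneg
    rw [this] at h1; norm_num at h1
  have h2 := Real.log_pos h1
  rw [Real.log_mul hv0.ne' (Real.exp_pos _).ne', Real.log_exp] at h2
  have hn0 : (0 : ℝ) < n := by exact_mod_cast hn1
  rw [neg_mul, one_div, inv_mul_eq_div, neg_le, le_div_iff₀ hn0]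
  nlinarith

end main

/-- Let `Γ` be a countable group acting measurably on `X`, `μ` a probability measure on `Γ`,
and `ν` a probability measure on `X` quasi-invariant under the action, with
`∑_g μ({g}) ∫ |log d(g⁻¹ν)/dν| dν < ∞`, and let
`E = -∑_g μ({g}) ∫ log d(g⁻¹ν)/dν dν` be the differential entropy. Let `P = μ^⊗ℤ` be the
Bernoulli measure on `Ω = Γ^ℤ`, and `π : Ω → X` a measurable map depending only on the
coordinates `(ω_n)_{n ≥ 1}`, with distribution `ν` and satisfying `π(ω) = ω₁ · π(Tω)` a.e.
Then, for `y_n(ω) = ω_{-n+1} ⋯ ω₀` and any `A` with `ν(A) > 0`, `P`-a.e.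
`limsup_n [-(1/n) log ν(y_n(ω) A)] ≤ E`. -/
theorem limsup_decay_translates_le_differential_entropy
    {Γ X : Type*} [Group Γ] [Countable Γ] [MeasurableSpace Γ] [MeasurableSingletonClass Γ]
    [MeasurableSpace X] [MulAction Γ X]
    (hmeas : ∀ g : Γ, Measurable fun x : X => g • x)
    (μ : Measure Γ) [IsProbabilityMeasure μ]
    (ν : Measure X) [IsProbabilityMeasure ν]
    (hqi : ∀ g : Γ, Measure.map (fun x : X => g • x) ν ≪ ν ∧
      ν ≪ Measure.map (fun x : X => g • x) ν)
    (hint : ∀ g : Γ, μ {g} ≠ 0 → Integrable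
      (fun x => Real.log (((Measure.map (fun x : X => g⁻¹ • x) ν).rnDeriv ν) x).toReal) ν)
    (hsum : Summable fun g : Γ => (μ {g}).toReal *
      ∫ x, |Real.log (((Measure.map (fun x : X => g⁻¹ • x) ν).rnDeriv ν) x).toReal| ∂ν)
    (E : ℝ)
    (hE : E = -∑' g : Γ, (μ {g}).toReal *
      ∫ x, Real.log (((Measure.map (fun x : X => g⁻¹ • x) ν).rnDeriv ν) x).toReal ∂ν)
    (P : Measure (ℤ → Γ)) [IsProbabilityMeasure P]
    (hP : ∀ (s : Finset ℤ) (B : ℤ → Set Γ),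
      P {ω : ℤ → Γ | ∀ i ∈ s, ω i ∈ B i} = ∏ i ∈ s, μ (B i))
    (π : (ℤ → Γ) → X) (hπmeas : Measurable π)
    (hπdep : ∀ ω ω' : ℤ → Γ, (∀ n : ℤ, 1 ≤ n → ω n = ω' n) → π ω = π ω')
    (hπdist : Measure.map π P = ν)
    (hπequiv : ∀ᵐ ω ∂P, π ω = ω 1 • π (fun n => ω (n + 1)))
    (A : Set X) (hA : MeasurableSet A) (hApos : 0 < ν A) :
    ∀ᵐ ω ∂P, limsup (fun n : ℕ =>
      -(1 / (n : ℝ)) *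
        Real.log (ν ((((List.range n).map fun i : ℕ => ω (1 - (n : ℤ) + i)).prod) • A)).toReal)
      atTop ≤ E := by
  have hP' : P = Measure.infinitePi (fun _ : ℤ => μ) := by
    refine Measure.eq_infinitePi _ fun s t _ => ?_
    rw [← hP s t]; rfl
  have hall : ∀ᵐ ω ∂P, ∀ k : ℕ, ∀ᶠ n : ℕ in atTop,
      -(1 / (n : ℝ)) * Real.log (ν (pastProd n ω • A)).toReal ≤
        E + 2 * (1 / ((k : ℝ) + 1)) := by
    rw [ae_all_iff]
    intro k
    exact main_aux hmeas μ ν hqi hint hsum E hE P hP' π hπmeas hπdep hπdist hπequiv A hA hApos _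
      (by positivity)
  filter_upwards [hall] with ω hω
  have hlim : Tendsto (fun k : ℕ => E + 2 * (1 / ((k : ℝ) + 1))) atTop (nhds (E + 2 * 0)) :=
    (tendsto_one_div_add_atTop_nhds_zero_nat.const_mul 2).const_add E
  rw [mul_zero, add_zero] at hlim
  refine ge_of_tendsto' hlim fun k => ?_
  refine limsup_le_of_le ?_ (hω k)
  refine IsBoundedUnder.isCoboundedUnder_le ⟨0, ?_⟩
  refine eventually_map.2 (Eventually.of_forall fun n => ?_)
  have h1 : Real.log (ν ((((List.range n).map
      fun i : ℕ => ω (1 - (n : ℤ) + i)).prod) • A)).toReal ≤ 0 :=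
    Real.log_nonpos ENNReal.toReal_nonneg measureReal_le_one
  have h2 : (0 : ℝ) ≤ 1 / (n : ℝ) := by positivity
  show 0 ≤ _
  nlinarith
end
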